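/- Suppose {P_n}_{n≥0} is a sequence of monic orthogonal polynomials for the Jacobi-type weight W_J. Then for every n ≥ 0 there exists a constant matrix Λ_n ∈ Mat_N(ℂ) such that P_n·D_J = Λ_n P_n (equality of matrix polynomials). In other words, the monic orthogonal polynomials of W_J are eigenfunctions of the second-order differential operator D_J, so W_J is a solution of the Matrix Bochner Problem. -/

import Mathlib

open Polynomial MeasureTheory Matrix

noncomputable section

abbrev Mat (N : ℕ) := Matrix (Fin N) (Fin N) ℂ

/-- The matrix unit with a `1` in the (1-indexed) entry `(s, t)` and `0` elsewhere. -/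
def EU (N : ℕ) (s t : ℕ) : Mat N :=
  Matrix.of fun p q => if (p : ℕ) + 1 = s ∧ (q : ℕ) + 1 = t then 1 else 0

/-- Evaluation of a matrix polynomial at a real point. -/
def mval {N : ℕ} (P : Polynomial (Mat N)) (x : ℝ) : Mat N :=
  Polynomial.eval ((x : ℂ) • (1 : Mat N)) P

/-- The nilpotent matrix `A = Σ a_{2j-1} E_{2j-1,2j} + Σ a_{2j} E_{2j+1,2j}`. -/
def Amat (N : ℕ) (a : ℕ → ℝ) : Mat N :=
  (∑ j ∈ Finset.Icc 1 (N / 2), (a (2 * j - 1) : ℂ) • EU N (2 * j - 1) (2 * j)) +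
  (∑ j ∈ Finset.Icc 1 ((N - 1) / 2), (a (2 * j) : ℂ) • EU N (2 * j + 1) (2 * j))

/-- `K = Σ_{j=1}^{⌊N/2⌋} E_{2j,2j}`. -/
def Kmat (N : ℕ) : Mat N := ∑ j ∈ Finset.Icc 1 (N / 2), EU N (2 * j) (2 * j)

/-- `T(x) = I + x A`. -/
def Tmat (N : ℕ) (a : ℕ → ℝ) (x : ℝ) : Mat N := 1 + (x : ℂ) • Amat N a

/-- The diagonal Jacobi weight `diag((1−x)^{α₁}(1+x)^{β₁}, …)` (1-indexed `α`, `β`). -/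
def jacobiDiag (N : ℕ) (α β : ℕ → ℝ) (x : ℝ) : Mat N :=
  Matrix.diagonal fun i =>
    (((1 - x) ^ α ((i : ℕ) + 1) * (1 + x) ^ β ((i : ℕ) + 1) : ℝ) : ℂ)

/-- The Jacobi-type weight `W_J(x) = T(x) · diag(…) · T(x)^*`. -/
def WJ (N : ℕ) (a α β : ℕ → ℝ) (x : ℝ) : Mat N :=
  Tmat N a x * jacobiDiag N α β x * (Tmat N a x)ᴴ

/-- `B = diag(β₁−α₁, …, β_N−α_N)`. -/
def BJ (N : ℕ) (α β : ℕ → ℝ) : Mat N :=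
  Matrix.diagonal fun i => ((β ((i : ℕ) + 1) - α ((i : ℕ) + 1) : ℝ) : ℂ)

/-- The right action of the differential operator `D_J`:
`P·D_J = (1−x²)P'' + P'·(2A + B + x(AB − BA + 2K − (α₁+β₁+2)I)) + P·(AB + (α₁+β₁)K)`. -/
def DJ {N : ℕ} (a α β : ℕ → ℝ) (P : Polynomial (Mat N)) : Polynomial (Mat N) :=
  (1 - Polynomial.X ^ 2) * derivative (derivative P)
    + derivative P * (Polynomial.C (2 • Amat N a + BJ N α β)
        + Polynomial.X *
            Polynomial.C (Amat N a * BJ N α β - BJ N α β * Amat N a + 2 • Kmat N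
              - ((α 1 + β 1 + 2 : ℝ) : ℂ) • (1 : Mat N)))
    + P * Polynomial.C (Amat N a * BJ N α β + ((α 1 + β 1 : ℝ) : ℂ) • Kmat N)

lemma gauge_identity {R : Type*} [Ring R] (A B K x c p0 p1 p2 : R)
    (hx : ∀ r, Commute x r) (hc : ∀ r, Commute c r)
    (hAK : A * K = A) (hKA : K * A = 0) (hAA : A * A = 0) (hABA : A * (B * A) = 0) :
    ((1 - x ^ 2) * p2 + p1 * ((2 * A + B) + x * (A * B - B * A + 2 * K - (c + 2)))
      + p0 * (A * B + c * K)) * (1 + x * A) =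
    (1 - x ^ 2) * (p2 * (1 + x * A) + 2 * (p1 * A))
      + (p1 * (1 + x * A) + p0 * A) * (B + x * (2 * K - (c + 2)))
      + p0 * (1 + x * A) * (c * K) := by
  have hx1 : ∀ r, r = A ∨ r = B ∨ r = K ∨ r = p0 ∨ r = p1 ∨ r = p2 → r * x = x * r :=
    fun r _ => (hx r).eq.symm
  have hx2 : ∀ r, r = A ∨ r = B ∨ r = K ∨ r = p0 ∨ r = p1 ∨ r = p2 →
      ∀ y, r * (x * y) = x * (r * y) := fun r _ y => (hx r).symm.left_comm y
  have hc1 : ∀ r, r = A ∨ r = B ∨ r = K ∨ r = p0 ∨ r = p1 ∨ r = p2 ∨ r = x → r * c = c * r :=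
    fun r _ => (hc r).eq.symm
  have hc2 : ∀ r, r = A ∨ r = B ∨ r = K ∨ r = p0 ∨ r = p1 ∨ r = p2 ∨ r = x →
      ∀ y, r * (c * y) = c * (r * y) := fun r _ y => (hc r).symm.left_comm y
  simp [mul_add, add_mul, mul_sub, sub_mul, mul_assoc, hx1, hx2, hc1, hc2, hAK, hKA, hAA,
    hABA, pow_two, two_mul, mul_two]
  abel

lemma matPolyEquiv_symm_derivative {N : ℕ} (P : Polynomial (Mat N)) (i j : Fin N) :
    matPolyEquiv.symm (derivative P) i j = derivative (matPolyEquiv.symm P i j) := by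
  ext k
  simp only [matPolyEquiv_symm_apply_coeff, coeff_derivative]
  rw [← Nat.cast_succ, ← nsmul_eq_mul', Matrix.smul_apply, nsmul_eq_mul']
  push_cast
  rfl

lemma matPolyEquiv_symm_X_mul {N : ℕ} (P : Polynomial (Mat N)) (i j : Fin N) :
    matPolyEquiv.symm (X * P) i j = X * matPolyEquiv.symm P i j := by
  rw [map_mul, matPolyEquiv_symm_X, Matrix.diagonal_mul]

lemma matPolyEquiv_symm_mul_C_diagonal {N : ℕ} (P : Polynomial (Mat N)) (d : Fin N → ℂ)
    (i j : Fin N) :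
    matPolyEquiv.symm (P * C (Matrix.diagonal d)) i j = matPolyEquiv.symm P i j * C (d j) := by
  rw [map_mul, matPolyEquiv_symm_C, Matrix.diagonal_map (by simp), Matrix.mul_diagonal]

lemma matPolyEquiv_symm_C_mul {N : ℕ} (M : Mat N) (P : Polynomial (Mat N)) (i j : Fin N) :
    matPolyEquiv.symm (C M * P) i j = ∑ k, C (M i k) * matPolyEquiv.symm P k j := by
  rw [map_mul, matPolyEquiv_symm_C, Matrix.mul_apply]
  rfl

lemma mval_apply {N : ℕ} (P : Polynomial (Mat N)) (x : ℝ) (i j : Fin N) :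
    mval P x i j = (matPolyEquiv.symm P i j).eval (x : ℂ) := by
  rw [← matPolyEquiv_eval, AlgEquiv.apply_symm_apply, mval]
  rw [Matrix.smul_one_eq_diagonal]
  rfl

lemma mval_mul {N : ℕ} (P Q : Polynomial (Mat N)) (x : ℝ) :
    mval (P * Q) x = mval P x * mval Q x := by
  ext i j
  simp [mval_apply, Matrix.mul_apply, eval_finsetSum]

/-- The matrix polynomial `1 + X A` with values `T(x)`. -/
def Tpoly (N : ℕ) (a : ℕ → ℝ) : Polynomial (Mat N) := 1 + X * C (Amat N a)

lemma mval_Tpoly (N : ℕ) (a : ℕ → ℝ) (x : ℝ) : mval (Tpoly N a) x = Tmat N a x := by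
  simp [mval, Tpoly, Tmat]

/-- The diagonal entries of `Kmat`. -/
def kdiag {N : ℕ} (i : Fin N) : ℝ := if (i : ℕ) % 2 = 1 then 1 else 0

lemma Kmat_eq (N : ℕ) : Kmat N = Matrix.diagonal fun i => (kdiag i : ℂ) := by
  ext i j
  have hi := i.2
  simp only [Kmat, Matrix.sum_apply, EU, Matrix.of_apply, Matrix.diagonal_apply, kdiag]
  split_ifs with h1 h2
  · subst h1
    rw [Finset.sum_eq_single_of_mem (((i : ℕ) + 1) / 2)]
    · rw [if_pos (by omega)]; simp
    · rw [Finset.mem_Icc]; omega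
    · intro b _ hb
      rw [if_neg (by omega)]
  · rw [Finset.sum_eq_zero]
    · simp
    · intro b _
      rw [if_neg (by omega)]
  · rw [Finset.sum_eq_zero]
    intro b _
    rw [if_neg]
    rw [Fin.ext_iff] at h1
    omega

lemma Amat_apply_eq_zero {N : ℕ} (a : ℕ → ℝ) (i j : Fin N)
    (h : ¬((i : ℕ) % 2 = 0 ∧ (j : ℕ) % 2 = 1)) : Amat N a i j = 0 := by
  simp only [Amat, Matrix.add_apply, Matrix.sum_apply, Matrix.smul_apply, EU, Matrix.of_apply]
  rw [Finset.sum_eq_zero, Finset.sum_eq_zero, add_zero]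
  all_goals
    intro b hb
    rw [Finset.mem_Icc] at hb
    rw [if_neg (by omega), smul_zero]

lemma Amat_mul_Kmat (N : ℕ) (a : ℕ → ℝ) : Amat N a * Kmat N = Amat N a := by
  ext i j
  rw [Kmat_eq, Matrix.mul_diagonal]
  by_cases h : (j : ℕ) % 2 = 1
  · simp [kdiag, h]
  · rw [Amat_apply_eq_zero a i j (by tauto), zero_mul]

lemma Kmat_mul_Amat (N : ℕ) (a : ℕ → ℝ) : Kmat N * Amat N a = 0 := by
  ext i j
  rw [Kmat_eq, Matrix.diagonal_mul]
  by_cases h : (i : ℕ) % 2 = 1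
  · rw [Amat_apply_eq_zero a i j (by omega), mul_zero]; rfl
  · simp [kdiag, h]

lemma Amat_mul_Amat (N : ℕ) (a : ℕ → ℝ) : Amat N a * Amat N a = 0 := by
  rw [← Amat_mul_Kmat, Matrix.mul_assoc, Amat_mul_Kmat, Kmat_mul_Amat, Matrix.mul_zero]

lemma Amat_mul_BJ_mul_Amat (N : ℕ) (a α β : ℕ → ℝ) :
    Amat N a * (BJ N α β * Amat N a) = 0 := by
  have hcomm : Kmat N * BJ N α β = BJ N α β * Kmat N := by
    rw [Kmat_eq, BJ, Matrix.diagonal_mul_diagonal, Matrix.diagonal_mul_diagonal]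
    simp only [mul_comm]
  rw [← Amat_mul_Kmat, Matrix.mul_assoc, ← Matrix.mul_assoc (Kmat N), hcomm, Amat_mul_Kmat,
    Matrix.mul_assoc (BJ N α β), Kmat_mul_Amat, Matrix.mul_zero, Matrix.mul_zero]

lemma DJ_mul_Tpoly {N : ℕ} (a α β : ℕ → ℝ) (P : Polynomial (Mat N)) :
    DJ a α β P * Tpoly N a =
      derivative (derivative (P * Tpoly N a)) - X * (X * derivative (derivative (P * Tpoly N a)))
      + derivative (P * Tpoly N a) * C (BJ N α β)
      + X * (derivative (P * Tpoly N a) *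
          C (Matrix.diagonal fun i => ((2 * kdiag i - (α 1 + β 1 + 2) : ℝ) : ℂ)))
      + P * Tpoly N a * C (Matrix.diagonal fun i => (((α 1 + β 1) * kdiag i : ℝ) : ℂ)) := by
  have hK1 : (Matrix.diagonal fun i => ((2 * kdiag i - (α 1 + β 1 + 2) : ℝ) : ℂ) : Mat N) =
      2 * Kmat N - (((α 1 + β 1 : ℝ) : ℂ) • (1 : Mat N) + 2) := by
    rw [Kmat_eq, Matrix.smul_one_eq_diagonal]
    ext i j
    by_cases h : i = j <;> simp [h, two_mul, Matrix.ofNat_apply]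
  have hK2 : (Matrix.diagonal fun i => (((α 1 + β 1) * kdiag i : ℝ) : ℂ) : Mat N) =
      (((α 1 + β 1 : ℝ) : ℂ) • (1 : Mat N)) * Kmat N := by
    rw [Kmat_eq, Matrix.smul_one_eq_diagonal, Matrix.diagonal_mul_diagonal]
    simp
  have hc2 : ((α 1 + β 1 + 2 : ℝ) : ℂ) • (1 : Mat N) =
      ((α 1 + β 1 : ℝ) : ℂ) • (1 : Mat N) + 2 := by
    push_cast
    rw [add_smul _ (2 : ℂ), two_smul, one_add_one_eq_two]
  have hc3 : ((α 1 + β 1 : ℝ) : ℂ) • Kmat N =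
      (((α 1 + β 1 : ℝ) : ℂ) • (1 : Mat N)) * Kmat N := by simp
  have hx : ∀ r : Polynomial (Mat N), Commute X r := fun r => X_mul
  have hc : ∀ r : Polynomial (Mat N), Commute (C (((α 1 + β 1 : ℝ) : ℂ) • (1 : Mat N))) r := by
    intro r
    ext1 k
    simp
  have h := gauge_identity (C (Amat N a)) (C (BJ N α β)) (C (Kmat N)) X
    (C (((α 1 + β 1 : ℝ) : ℂ) • (1 : Mat N))) P (derivative P) (derivative (derivative P)) hx hc
    (by rw [← C_mul, Amat_mul_Kmat]) (by rw [← C_mul, Kmat_mul_Amat, C_0])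
    (by rw [← C_mul, Amat_mul_Amat, C_0])
    (by rw [← C_mul, ← C_mul, Amat_mul_BJ_mul_Amat, C_0])
  have d1 : derivative (P * Tpoly N a) =
      derivative P * (1 + X * C (Amat N a)) + P * C (Amat N a) := by
    simp [Tpoly]
  have d2 : derivative (derivative (P * Tpoly N a)) =
      derivative (derivative P) * (1 + X * C (Amat N a)) + 2 * (derivative P * C (Amat N a)) := by
    rw [d1]
    simp [two_mul, add_assoc]
  have hl : DJ a α β P * Tpoly N a = _ := Eq.trans ?_ h
  · rw [hl, d2, d1, hK1, hK2, Tpoly]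
    simp only [C_sub, C_add, C_mul, C_ofNat]
    generalize derivative P * (1 + X * C (Amat N a)) + P * C (Amat N a) = u
    rw [mul_add u, ← mul_assoc u X, ← X_mul, mul_assoc X u, pow_two, sub_mul, one_mul, mul_assoc X X]
    abel
  · rw [DJ, Tpoly, hc2, hc3]
    simp only [C_sub, C_add, C_mul, two_smul, two_mul, C_ofNat]

/-- The scalar Jacobi weight `(1 - x)^α (1 + x)^β`. -/
def jacobiWeight (α β x : ℝ) : ℝ := (1 - x) ^ α * (1 + x) ^ β

lemma intervalIntegrable_jacobiWeight {α β : ℝ} (hα : -1 < α) (hβ : -1 < β) :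
    IntervalIntegrable (jacobiWeight α β) volume (-1) 1 := by
  refine IntervalIntegrable.trans (b := 0) ?_ ?_
  · refine IntervalIntegrable.continuousOn_mul ?_ ?_
    · simpa using (intervalIntegral.intervalIntegrable_rpow' (a := 0) (b := 1) hβ).comp_add_left 1
    · refine ContinuousOn.rpow_const (by fun_prop) fun x hx => Or.inl ?_
      rw [Set.uIcc_of_le (by norm_num)] at hx
      linarith [hx.2]
  · refine IntervalIntegrable.mul_continuousOn ?_ ?_
    · simpa using (intervalIntegral.intervalIntegrable_rpow' (a := 1) (b := 0) hα).comp_sub_left 1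
    · refine ContinuousOn.rpow_const (by fun_prop) fun x hx => Or.inl ?_
      rw [Set.uIcc_of_le (by norm_num)] at hx
      linarith [hx.1]

lemma intervalIntegrable_jacobiWeight_mul_eval {α β : ℝ} (hα : -1 < α) (hβ : -1 < β)
    (p : Polynomial ℂ) :
    IntervalIntegrable (fun x : ℝ => (jacobiWeight α β x : ℂ) * p.eval (x : ℂ))
      volume (-1) 1 := by
  refine IntervalIntegrable.mul_continuousOn ?_ ?_
  · exact ⟨(intervalIntegrable_jacobiWeight hα hβ).1.ofReal,
      (intervalIntegrable_jacobiWeight hα hβ).2.ofReal⟩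
  · exact (p.continuous.comp Complex.continuous_ofReal).continuousOn

/-- The moment functional `p ↦ ∫ p(x) (1 - x)^α (1 + x)^β dx` over `[-1, 1]`. -/
def jacobiMoment (α β : ℝ) (p : Polynomial ℂ) : ℂ :=
  ∫ x in (-1 : ℝ)..1, (jacobiWeight α β x : ℂ) * p.eval (x : ℂ)

lemma jacobiMoment_add {α β : ℝ} (hα : -1 < α) (hβ : -1 < β) (p q : Polynomial ℂ) :
    jacobiMoment α β (p + q) = jacobiMoment α β p + jacobiMoment α β q := by
  simp only [jacobiMoment, eval_add, mul_add]
  exact intervalIntegral.integral_add (intervalIntegrable_jacobiWeight_mul_eval hα hβ p)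
    (intervalIntegrable_jacobiWeight_mul_eval hα hβ q)

lemma jacobiMoment_sub {α β : ℝ} (hα : -1 < α) (hβ : -1 < β) (p q : Polynomial ℂ) :
    jacobiMoment α β (p - q) = jacobiMoment α β p - jacobiMoment α β q := by
  rw [eq_sub_iff_add_eq, ← jacobiMoment_add hα hβ, sub_add_cancel]

lemma jacobiMoment_C_mul (α β : ℝ) (c : ℂ) (p : Polynomial ℂ) :
    jacobiMoment α β (C c * p) = c * jacobiMoment α β p := by
  simp only [jacobiMoment, eval_mul, eval_C, mul_left_comm _ c]
  exact intervalIntegral.integral_const_mul _ _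

lemma jacobiMoment_sum {α β : ℝ} (hα : -1 < α) (hβ : -1 < β) {ι : Type*} (s : Finset ι)
    (f : ι → Polynomial ℂ) :
    jacobiMoment α β (∑ i ∈ s, f i) = ∑ i ∈ s, jacobiMoment α β (f i) := by
  simp only [jacobiMoment, eval_finsetSum, Finset.mul_sum]
  exact intervalIntegral.integral_finsetSum fun i _ =>
    intervalIntegrable_jacobiWeight_mul_eval hα hβ (f i)

/-- The scalar Jacobi operator. -/
def jacobiOp (α β : ℝ) (p : Polynomial ℂ) : Polynomial ℂ :=
  derivative (derivative p) - X * (X * derivative (derivative p))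
    + derivative p * C ((β - α : ℝ) : ℂ) + X * (derivative p * C ((-(α + β + 2) : ℝ) : ℂ))

lemma hasDerivAt_jacobiWeight_succ {α β x : ℝ} (hx : x ∈ Set.Ioo (-1 : ℝ) 1) :
    HasDerivAt (jacobiWeight (α + 1) (β + 1))
      (jacobiWeight α β x * (β - α - x * (α + β + 2))) x := by
  have h1 : 0 < 1 - x := by linarith [hx.2]
  have h2 : 0 < 1 + x := by linarith [hx.1]
  have e1 := ((hasDerivAt_id x).const_sub 1).rpow_const (p := α + 1) (Or.inl h1.ne')
  have e2 := ((hasDerivAt_id x).const_add 1).rpow_const (p := β + 1) (Or.inl h2.ne')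
  refine (e1.mul e2).congr_deriv ?_
  simp only [id, jacobiWeight, add_sub_cancel_right, Real.rpow_add_one h1.ne',
    Real.rpow_add_one h2.ne']
  ring

lemma jacobiWeight_succ {α β x : ℝ} (hx : x ∈ Set.Ioo (-1 : ℝ) 1) :
    jacobiWeight (α + 1) (β + 1) x = jacobiWeight α β x * (1 - x ^ 2) := by
  have h1 : 0 < 1 - x := by linarith [hx.2]
  have h2 : 0 < 1 + x := by linarith [hx.1]
  simp only [jacobiWeight, Real.rpow_add_one h1.ne', Real.rpow_add_one h2.ne']
  ring

lemma jacobiMoment_jacobiOp_mul {α β : ℝ} (hα : -1 < α) (hβ : -1 < β) (p q : Polynomial ℂ) :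
    jacobiMoment α β (jacobiOp α β p * q) = jacobiMoment α β (p * jacobiOp α β q) := by
  rw [← sub_eq_zero, ← jacobiMoment_sub hα hβ]
  let g : Polynomial ℂ := derivative p * q - p * derivative q
  have hg : ∀ x : ℝ, HasDerivAt (fun y : ℝ => g.eval (y : ℂ)) ((derivative g).eval (x : ℂ)) x :=
    fun x => (g.hasDerivAt (x : ℂ)).comp_ofReal
  have hcont : ContinuousOn (fun x : ℝ => (jacobiWeight (α + 1) (β + 1) x : ℂ) * g.eval (x : ℂ))
      (Set.Icc (-1) 1) := by
    refine ContinuousOn.mul (Complex.continuous_ofReal.comp_continuousOn ?_)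
      (g.continuous.comp Complex.continuous_ofReal).continuousOn
    refine ContinuousOn.mul ?_ ?_
    · exact ContinuousOn.rpow_const (by fun_prop) fun x _ => Or.inr (by linarith)
    · exact ContinuousOn.rpow_const (by fun_prop) fun x _ => Or.inr (by linarith)
  have h := intervalIntegral.integral_eq_sub_of_hasDerivAt_of_le (by norm_num) hcont
    (f' := fun x : ℝ => (jacobiWeight α β x : ℂ) *
      (jacobiOp α β p * q - p * jacobiOp α β q).eval (x : ℂ)) ?_
    (intervalIntegrable_jacobiWeight_mul_eval hα hβ _)
  · rw [jacobiMoment, h]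
    simp [jacobiWeight, Real.zero_rpow (by linarith : α + 1 ≠ 0),
      Real.zero_rpow (by linarith : β + 1 ≠ 0)]
  · intro x hx
    refine ((hasDerivAt_jacobiWeight_succ (α := α) (β := β) hx).ofReal_comp.mul
      (hg x)).congr_deriv ?_
    rw [jacobiWeight_succ hx]
    simp only [g, jacobiOp, derivative_sub, derivative_mul, eval_sub, eval_add, eval_mul, eval_X,
      eval_C]
    push_cast
    ring

lemma eval_ofReal_map_conj (p : Polynomial ℂ) (x : ℝ) :
    (p.map (starRingEnd ℂ)).eval (x : ℂ) = starRingEnd ℂ (p.eval (x : ℂ)) := by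
  rw [← eval_map_apply, Complex.conj_ofReal]

lemma map_conj_jacobiOp (α β : ℝ) (p : Polynomial ℂ) :
    (jacobiOp α β p).map (starRingEnd ℂ) = jacobiOp α β (p.map (starRingEnd ℂ)) := by
  simp only [jacobiOp, derivative_map, Polynomial.map_add, Polynomial.map_sub, Polynomial.map_mul,
    map_X, map_C, Complex.conj_ofReal]

lemma jacobiMoment_mul_conj (α β : ℝ) (p : Polynomial ℂ) :
    jacobiMoment α β (p * p.map (starRingEnd ℂ)) =
      ((∫ x in (-1 : ℝ)..1, jacobiWeight α β x * ‖p.eval (x : ℂ)‖ ^ 2 : ℝ) : ℂ) := by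
  rw [jacobiMoment, ← intervalIntegral.integral_ofReal]
  refine intervalIntegral.integral_congr fun x _ => ?_
  simp only [eval_mul, eval_ofReal_map_conj, Complex.mul_conj']
  push_cast
  rfl

lemma jacobiWeight_pos {α β x : ℝ} (hx : x ∈ Set.Ioo (-1 : ℝ) 1) : 0 < jacobiWeight α β x :=
  mul_pos (Real.rpow_pos_of_pos (by linarith [hx.2]) _)
    (Real.rpow_pos_of_pos (by linarith [hx.1]) _)

lemma integral_jacobiWeight_mul_norm_sq_nonneg (α β : ℝ) (p : Polynomial ℂ) :
    0 ≤ ∫ x in (-1 : ℝ)..1, jacobiWeight α β x * ‖p.eval (x : ℂ)‖ ^ 2 := by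
  refine intervalIntegral.integral_nonneg (by norm_num) fun x hx => ?_
  exact mul_nonneg (mul_nonneg (Real.rpow_nonneg (by linarith [hx.2]) _)
    (Real.rpow_nonneg (by linarith [hx.1]) _)) (sq_nonneg _)

lemma eq_zero_of_integral_jacobiWeight_eq_zero {α β : ℝ} (hα : -1 < α) (hβ : -1 < β)
    {p : Polynomial ℂ}
    (h : ∫ x in (-1 : ℝ)..1, jacobiWeight α β x * ‖p.eval (x : ℂ)‖ ^ 2 = 0) : p = 0 := by
  have hint : IntervalIntegrable (fun x : ℝ => jacobiWeight α β x * ‖p.eval (x : ℂ)‖ ^ 2)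
      volume (-1) 1 := by
    refine (intervalIntegrable_jacobiWeight hα hβ).mul_continuousOn ?_
    exact ((p.continuous.comp Complex.continuous_ofReal).norm.pow 2).continuousOn
  by_contra hp
  refine (?_ : ¬ ∫ x in (-1 : ℝ)..1, jacobiWeight α β x * ‖p.eval (x : ℂ)‖ ^ 2 = 0) h
  have hfin : {x : ℝ | p.eval (x : ℂ) = 0}.Finite :=
    Set.Finite.preimage (f := ((↑) : ℝ → ℂ)) Complex.ofReal_injective.injOn
      (s := {z | p.IsRoot z}) (Polynomial.finite_setOfPred_isRoot hp)
  refine ne_of_gt ((intervalIntegral.integral_pos_iff_support_of_nonneg_ae' ?_ hint).2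
    ⟨by norm_num, ?_⟩)
  · rw [Set.uIoc_of_le (by norm_num)]
    filter_upwards [ae_restrict_mem measurableSet_Ioc] with x hx
    exact mul_nonneg (mul_nonneg (Real.rpow_nonneg (by linarith [hx.2]) _)
      (Real.rpow_nonneg (by linarith [hx.1]) _)) (sq_nonneg _)
  · have hsub : Set.Ioo (-1 : ℝ) 1 \ {x : ℝ | p.eval (x : ℂ) = 0} ⊆
        Function.support (fun x : ℝ => jacobiWeight α β x * ‖p.eval (x : ℂ)‖ ^ 2) ∩
          Set.Ioc (-1) 1 := by
      rintro x ⟨hx, hx0⟩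
      refine ⟨mul_ne_zero (jacobiWeight_pos hx).ne' (pow_ne_zero _ (norm_ne_zero_iff.2 hx0)),
        Set.Ioo_subset_Ioc_self hx⟩
    refine lt_of_lt_of_le ?_ (measure_mono hsub)
    rw [measure_sdiff_null (hfin.measure_zero _)]
    simp

/-- The matrix-valued sesquilinear pairing `∫ P W_J Q^*`, written through the scalar Jacobi
moments of the entries of `P T` and `Q T`. -/
def pairing {N : ℕ} (a α β : ℕ → ℝ) (P Q : Polynomial (Mat N)) : Mat N :=
  Matrix.of fun s t => ∑ j : Fin N, jacobiMoment (α ((j : ℕ) + 1)) (β ((j : ℕ) + 1))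
    (matPolyEquiv.symm (P * Tpoly N a) s j *
      (matPolyEquiv.symm (Q * Tpoly N a) t j).map (starRingEnd ℂ))

lemma integral_eq_pairing {N : ℕ} (a : ℕ → ℝ) {α β : ℕ → ℝ}
    (hαβ : ∀ j, 1 ≤ j → j ≤ N → -1 < α j ∧ -1 < β j) (P Q : Polynomial (Mat N)) (s t : Fin N) :
    ∫ x in Set.Ioo (-1 : ℝ) 1, (mval P x * WJ N a α β x * (mval Q x)ᴴ) s t =
      pairing a α β P Q s t := by
  have hval : ∀ x : ℝ, (mval P x * WJ N a α β x * (mval Q x)ᴴ) s t =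
      ∑ j : Fin N, (jacobiWeight (α ((j : ℕ) + 1)) (β ((j : ℕ) + 1)) x : ℂ) *
        (matPolyEquiv.symm (P * Tpoly N a) s j *
          (matPolyEquiv.symm (Q * Tpoly N a) t j).map (starRingEnd ℂ)).eval (x : ℂ) := by
    intro x
    have h : mval P x * WJ N a α β x * (mval Q x)ᴴ =
        mval (P * Tpoly N a) x * jacobiDiag N α β x * (mval (Q * Tpoly N a) x)ᴴ := by
      rw [WJ, mval_mul, mval_mul, mval_Tpoly, Matrix.conjTranspose_mul]
      simp only [Matrix.mul_assoc]
    rw [h, Matrix.mul_apply]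
    refine Finset.sum_congr rfl fun j _ => ?_
    rw [jacobiDiag, Matrix.mul_diagonal, Matrix.conjTranspose_apply, mval_apply, mval_apply,
      eval_mul, eval_ofReal_map_conj, jacobiWeight]
    simp only [← starRingEnd_apply]
    ring
  simp only [hval, pairing, Matrix.of_apply, jacobiMoment]
  rw [← integral_Ioc_eq_integral_Ioo, ← intervalIntegral.integral_of_le (by norm_num)]
  exact intervalIntegral.integral_finsetSum fun j _ =>
    have hj := hαβ ((j : ℕ) + 1) (by omega) (by omega)
    intervalIntegrable_jacobiWeight_mul_eval hj.1 hj.2 _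

section Pairing

variable {N : ℕ} (a : ℕ → ℝ) {α β : ℕ → ℝ}

lemma pairing_sub_left (hαβ : ∀ j, 1 ≤ j → j ≤ N → -1 < α j ∧ -1 < β j)
    (P P' Q : Polynomial (Mat N)) :
    pairing a α β (P - P') Q = pairing a α β P Q - pairing a α β P' Q := by
  ext s t
  simp only [pairing, Matrix.of_apply, Matrix.sub_apply, ← Finset.sum_sub_distrib]
  refine Finset.sum_congr rfl fun j _ => ?_
  have hj := hαβ ((j : ℕ) + 1) (by omega) (by omega)
  rw [← jacobiMoment_sub hj.1 hj.2, sub_mul, map_sub, Matrix.sub_apply, sub_mul]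

lemma pairing_sub_right (hαβ : ∀ j, 1 ≤ j → j ≤ N → -1 < α j ∧ -1 < β j)
    (P Q Q' : Polynomial (Mat N)) :
    pairing a α β P (Q - Q') = pairing a α β P Q - pairing a α β P Q' := by
  ext s t
  simp only [pairing, Matrix.of_apply, Matrix.sub_apply, ← Finset.sum_sub_distrib]
  refine Finset.sum_congr rfl fun j _ => ?_
  have hj := hαβ ((j : ℕ) + 1) (by omega) (by omega)
  rw [← jacobiMoment_sub hj.1 hj.2, sub_mul, map_sub, Matrix.sub_apply, Polynomial.map_sub,
    mul_sub]

lemma pairing_C_mul_left (hαβ : ∀ j, 1 ≤ j → j ≤ N → -1 < α j ∧ -1 < β j)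
    (M : Mat N) (P Q : Polynomial (Mat N)) :
    pairing a α β (C M * P) Q = M * pairing a α β P Q := by
  ext s t
  simp only [pairing, Matrix.of_apply, Matrix.mul_apply, Finset.mul_sum]
  rw [Finset.sum_comm]
  refine Finset.sum_congr rfl fun j _ => ?_
  have hj := hαβ ((j : ℕ) + 1) (by omega) (by omega)
  rw [mul_assoc, matPolyEquiv_symm_C_mul, Finset.sum_mul, jacobiMoment_sum hj.1 hj.2]
  simp only [mul_assoc, jacobiMoment_C_mul]

lemma pairing_C_mul_right (hαβ : ∀ j, 1 ≤ j → j ≤ N → -1 < α j ∧ -1 < β j)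
    (M : Mat N) (P Q : Polynomial (Mat N)) :
    pairing a α β P (C M * Q) = pairing a α β P Q * Mᴴ := by
  ext s t
  simp only [pairing, Matrix.of_apply, Matrix.mul_apply, Finset.sum_mul]
  rw [Finset.sum_comm]
  refine Finset.sum_congr rfl fun j _ => ?_
  have hj := hαβ ((j : ℕ) + 1) (by omega) (by omega)
  rw [mul_assoc, matPolyEquiv_symm_C_mul, Polynomial.map_sum, Finset.mul_sum,
    jacobiMoment_sum hj.1 hj.2]
  refine Finset.sum_congr rfl fun k _ => ?_
  rw [Polynomial.map_mul, map_C, mul_left_comm, jacobiMoment_C_mul, mul_comm]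
  rfl

lemma pairing_self_eq_zero (hαβ : ∀ j, 1 ≤ j → j ≤ N → -1 < α j ∧ -1 < β j)
    {P : Polynomial (Mat N)} (h : pairing a α β P P = 0) : P = 0 := by
  have hPT : P * Tpoly N a = 0 := by
    rw [← map_eq_zero_iff _ matPolyEquiv.symm.injective]
    ext1 s j
    have hs := congrFun (congrFun h s) s
    simp only [pairing, Matrix.of_apply, jacobiMoment_mul_conj, Matrix.zero_apply] at hs
    rw [← Complex.ofReal_sum, Complex.ofReal_eq_zero, Finset.sum_eq_zero_iff_of_nonneg
      fun _ _ => integral_jacobiWeight_mul_norm_sq_nonneg _ _ _] at hs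
    have hj := hαβ ((j : ℕ) + 1) (by omega) (by omega)
    exact eq_zero_of_integral_jacobiWeight_eq_zero hj.1 hj.2 (hs j (Finset.mem_univ j))
  have hinv : Tpoly N a * (1 - X * C (Amat N a)) = 1 := by
    have h2 : X * C (Amat N a) * (X * C (Amat N a)) = 0 := by
      rw [mul_assoc, ← mul_assoc (C _) X, ← X_mul, mul_assoc, ← C_mul, Amat_mul_Amat]
      simp
    rw [Tpoly, add_mul, mul_sub, mul_sub, h2]
    simp
  rw [← mul_one P, ← hinv, ← mul_assoc, hPT, zero_mul]

lemma matPolyEquiv_symm_DJ_mul_Tpoly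
    (hsum : ∀ j, 1 ≤ j → j ≤ N → α 1 + β 1 = α j + β j + 1 + (-1 : ℝ) ^ j)
    (P : Polynomial (Mat N)) (s j : Fin N) :
    matPolyEquiv.symm (DJ a α β P * Tpoly N a) s j =
      jacobiOp (α ((j : ℕ) + 1)) (β ((j : ℕ) + 1)) (matPolyEquiv.symm (P * Tpoly N a) s j)
      + C (((α 1 + β 1) * kdiag j : ℝ) : ℂ) * matPolyEquiv.symm (P * Tpoly N a) s j := by
  have hk : 2 * kdiag j - (α 1 + β 1 + 2) = -(α ((j : ℕ) + 1) + β ((j : ℕ) + 1) + 2) := by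
    rw [hsum ((j : ℕ) + 1) (by omega) (by omega), kdiag]
    rcases Nat.even_or_odd (j : ℕ) with h | h
    · rw [h.add_one.neg_one_pow, if_neg (by rw [Nat.even_iff.1 h]; norm_num)]
      ring
    · rw [h.add_one.neg_one_pow, if_pos (Nat.odd_iff.1 h)]
      ring
  rw [DJ_mul_Tpoly, BJ]
  simp only [map_add, map_sub, Matrix.add_apply, Matrix.sub_apply, matPolyEquiv_symm_X_mul,
    matPolyEquiv_symm_mul_C_diagonal, matPolyEquiv_symm_derivative, hk, jacobiOp]
  rw [mul_comm (C (((α 1 + β 1) * kdiag j : ℝ) : ℂ))]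

lemma pairing_DJ (hαβ : ∀ j, 1 ≤ j → j ≤ N → -1 < α j ∧ -1 < β j)
    (hsum : ∀ j, 1 ≤ j → j ≤ N → α 1 + β 1 = α j + β j + 1 + (-1 : ℝ) ^ j)
    (P Q : Polynomial (Mat N)) :
    pairing a α β (DJ a α β P) Q = pairing a α β P (DJ a α β Q) := by
  ext s t
  simp only [pairing, Matrix.of_apply]
  refine Finset.sum_congr rfl fun j _ => ?_
  have hj := hαβ ((j : ℕ) + 1) (by omega) (by omega)
  rw [matPolyEquiv_symm_DJ_mul_Tpoly a hsum, matPolyEquiv_symm_DJ_mul_Tpoly a hsum, add_mul,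
    Polynomial.map_add, mul_add, jacobiMoment_add hj.1 hj.2, jacobiMoment_add hj.1 hj.2,
    jacobiMoment_jacobiOp_mul hj.1 hj.2, map_conj_jacobiOp, Polynomial.map_mul, map_C,
    Complex.conj_ofReal, mul_assoc, mul_left_comm _ (C _)]

end Pairing

lemma natDegree_X_pow_mul_iterate_derivative_le {R : Type*} [Semiring R] {p : Polynomial R}
    {n : ℕ} (hp : p.natDegree ≤ n) (k : ℕ) : (X ^ k * derivative^[k] p).natDegree ≤ n := by
  rw [natDegree_le_iff_coeff_eq_zero] at hp ⊢
  intro m hm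
  rw [coeff_X_pow_mul']
  split_ifs with h
  · rw [coeff_iterate_derivative, Nat.sub_add_cancel h, hp m hm, smul_zero]
  · rfl

lemma natDegree_DJ_le {N : ℕ} (a α β : ℕ → ℝ) {P : Polynomial (Mat N)} {n : ℕ}
    (hP : P.natDegree ≤ n) : (DJ a α β P).natDegree ≤ n := by
  have h1 : (derivative P).natDegree ≤ n := (natDegree_derivative_le P).trans (by omega)
  have h2 : (derivative (derivative P)).natDegree ≤ n :=
    (natDegree_derivative_le _).trans (by omega)
  have hC : ∀ (Q : Polynomial (Mat N)) (M : Mat N), Q.natDegree ≤ n → (Q * C M).natDegree ≤ n :=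
    fun Q M hQ => (natDegree_mul_C_le Q M).trans hQ
  have hX1 := natDegree_X_pow_mul_iterate_derivative_le hP 1
  have hX2 := natDegree_X_pow_mul_iterate_derivative_le hP 2
  simp only [pow_one, Function.iterate_succ, Function.iterate_zero, Function.comp_apply,
    id] at hX1 hX2
  rw [DJ, sub_mul, one_mul, mul_add (derivative P), ← mul_assoc (derivative P), ← X_mul]
  exact natDegree_add_le_of_degree_le (natDegree_add_le_of_degree_le
    ((natDegree_sub_le _ _).trans (max_le h2 hX2))
    (natDegree_add_le_of_degree_le (hC _ _ h1) (hC _ _ hX1))) (hC _ _ hP)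

lemma degree_sub_C_coeff_mul_lt {R : Type*} [Ring R] {p q : Polynomial R} {n : ℕ}
    (hp : p.natDegree ≤ n) (hq : q.natDegree = n) (hmonic : q.Monic) :
    (p - C (p.coeff n) * q).degree < n := by
  rw [degree_lt_iff_coeff_zero]
  intro m hm
  rcases hm.eq_or_lt with rfl | hlt
  · have : q.coeff n = 1 := by rw [← hq]; exact hmonic
    simp [this]
  · rw [coeff_sub, coeff_C_mul, coeff_eq_zero_of_natDegree_lt (hp.trans_lt hlt),
      coeff_eq_zero_of_natDegree_lt (hq.trans_lt hlt)]
    simp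

lemma pairing_eq_zero_of_degree_lt {N : ℕ} (a : ℕ → ℝ) {α β : ℕ → ℝ}
    (hαβ : ∀ j, 1 ≤ j → j ≤ N → -1 < α j ∧ -1 < β j) {P : ℕ → Polynomial (Mat N)}
    (hdeg : ∀ n, (P n).natDegree = n) (hmonic : ∀ n, (P n).Monic)
    {F : Polynomial (Mat N)} {n : ℕ} (hF : ∀ m < n, pairing a α β F (P m) = 0)
    {Q : Polynomial (Mat N)} (hQ : Q.degree < n) : pairing a α β F Q = 0 := by
  induction n generalizing Q with
  | zero =>
    have : Q = 0 := by simpa using hQ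
    subst this
    simpa using pairing_C_mul_right a hαβ 0 F 0
  | succ n ih =>
    have hQn : Q.natDegree ≤ n := natDegree_le_of_degree_le (Order.lt_succ_iff.1 hQ)
    have h := ih (fun m hm => hF m (hm.trans n.lt_succ_self))
      (degree_sub_C_coeff_mul_lt hQn (hdeg n) (hmonic n))
    rwa [pairing_sub_right a hαβ, pairing_C_mul_right a hαβ, hF n n.lt_succ_self,
      Matrix.zero_mul, sub_zero] at h

/-- the monic orthogonal polynomials of `W_J` are eigenfunctions of `D_J`. -/
theorem stmt2 (N : ℕ) (hN : 2 ≤ N) (a : ℕ → ℝ)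
    (ha : ∀ j, 1 ≤ j → j ≤ N - 1 → a j ≠ 0)
    (α β : ℕ → ℝ)
    (hαβ : ∀ j, 1 ≤ j → j ≤ N → -1 < α j ∧ -1 < β j)
    (hsum : ∀ j, 1 ≤ j → j ≤ N → α 1 + β 1 = α j + β j + 1 + (-1 : ℝ) ^ j)
    (hint : ∀ i j, 1 ≤ i → i ≤ N → 1 ≤ j → j ≤ N → i ≠ j →
      (¬ ∃ k : ℤ, α i - α j = (k : ℝ)) ∨ (¬ ∃ k : ℤ, β i - β j = (k : ℝ)))
    (P : ℕ → Polynomial (Mat N))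
    (hdeg : ∀ n, (P n).natDegree = n)
    (hmonic : ∀ n, (P n).Monic)
    (horth : ∀ n m, n ≠ m → ∀ s t : Fin N,
      ∫ x in Set.Ioo (-1 : ℝ) 1, (mval (P n) x * WJ N a α β x * (mval (P m) x)ᴴ) s t = 0) :
    ∀ n : ℕ, ∃ Λ : Mat N, DJ a α β (P n) = Polynomial.C Λ * P n := by
  intro n
  have hP : ∀ n m, n ≠ m → pairing a α β (P n) (P m) = 0 := fun n m hnm => by
    ext s t
    rw [← integral_eq_pairing a hαβ, horth n m hnm]
    rfl
  refine ⟨(DJ a α β (P n)).coeff n, sub_eq_zero.1 (pairing_self_eq_zero a hαβ ?_)⟩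
  refine pairing_eq_zero_of_degree_lt a hαβ hdeg hmonic (fun m hm => ?_)
    (degree_sub_C_coeff_mul_lt (natDegree_DJ_le a α β (hdeg n).le) (hdeg n) (hmonic n))
  have hdm : (DJ a α β (P m)).degree < n :=
    (degree_le_of_natDegree_le (natDegree_DJ_le a α β (hdeg m).le)).trans_lt (by exact_mod_cast hm)
  rw [pairing_sub_left a hαβ, pairing_C_mul_left a hαβ, hP n m hm.ne', Matrix.mul_zero, sub_zero,
    pairing_DJ a hαβ hsum]
  exact pairing_eq_zero_of_degree_lt a hαβ hdeg hmonic (fun k hk => hP n k hk.ne') hdm
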